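/- Let G = G1 ×_I G2 be a discrete cusp with I ⊆ V2 nonempty, and set M := (sup_{x∈V1} deg_{G1}(x)) · (max_{y∈V2} 1/m2(y)) < ∞. Then: (i) for all (x,y) ∈ V1 × V2, deg_{G2}(y)/m1(x) ≤ deg_G(x,y) ≤ deg_{G2}(y)/m1(x) + M; (ii) for every finitely supported f : V1 × V2 → ℂ, Σ_{x∈V1} Q_{G2,θ2}(f(x,·)) ≤ Q_{G,θ}(f) ≤ 2M·‖f‖² + Σ_{x∈V1} Q_{G2,θ2}(f(x,·)), where ‖f‖² = Σ_{(x,y)} m1(x)m2(y)|f(x,y)|²; that is, m1^{-1}(·) ⊗ Δ_{G2,θ2} ≤ Δ_{G,θ} ≤ 2M + m1^{-1}(·) ⊗ Δ_{G2,θ2} in the form sense on finitely supported functions. -/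

import Mathlib

open scoped BigOperators ENNReal

noncomputable section

namespace MagneticCusp

attribute [local instance] Classical.propDecidable

variable {V V1 V2 : Type*}

/-- The axioms of a weighted graph `(E, V, m)`: `E` is symmetric, non-negative,
with no loops, `m` is a positive weight, and the graph is locally finite. -/
def GraphAxioms (E : V → V → ℝ) (m : V → ℝ) : Prop :=
  (∀ x y, E x y = E y x) ∧ (∀ x y, 0 ≤ E x y) ∧ (∀ x, E x x = 0) ∧ (∀ x, 0 < m x) ∧
    ∀ x, {y | 0 < E x y}.Finite

/-- Connectedness of the graph with edge weight `E`. -/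
def Conn (E : V → V → ℝ) : Prop :=
  ∀ x y, Relation.ReflTransGen (fun a b => 0 < E a b) x y

/-- A (real representative of a) magnetic potential: antisymmetric, vanishing off edges. -/
def MagneticPotential (E θ : V → V → ℝ) : Prop :=
  (∀ x y, θ y x = -θ x y) ∧ ∀ x y, E x y = 0 → θ x y = 0

/-- `γ` is a cycle of length `N` in the graph with edge weight `E`. -/
def IsCycle (E : V → V → ℝ) (γ : ℕ → V) (N : ℕ) : Prop :=
  γ N = γ 0 ∧ ∀ i < N, 0 < E (γ i) (γ (i + 1))

/-- The holonomy (flux) of the magnetic potential `θ` along `γ` (a real representative;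
it is to be considered modulo `2π`). -/
def hol (θ : V → V → ℝ) (γ : ℕ → V) (N : ℕ) : ℝ :=
  ∑ i ∈ Finset.range N, θ (γ i) (γ (i + 1))

/-- `Hol_θ = 0`: every cycle has vanishing holonomy in `ℝ/2πℤ`. -/
def HolTrivial (E θ : V → V → ℝ) : Prop :=
  ∀ (γ : ℕ → V) (N : ℕ), IsCycle E γ N → ∃ k : ℤ, hol θ γ N = 2 * Real.pi * k

/-- The magnetic Laplacian `Δ_{G,θ}` acting on functions. -/
def lap (E : V → V → ℝ) (m : V → ℝ) (θ : V → V → ℝ) (f : V → ℂ) (x : V) : ℂ :=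
  ((m x : ℝ) : ℂ)⁻¹ *
    ∑' y, ((E x y : ℝ) : ℂ) * (f x - Complex.exp (((θ x y : ℝ) : ℂ) * Complex.I) * f y)

/-- The magnetic quadratic form `Q_{G,θ}`. -/
def quadForm (E θ : V → V → ℝ) (f : V → ℂ) : ℝ :=
  (1 / 2) * ∑' x, ∑' y, E x y * ‖f x - Complex.exp (((θ x y : ℝ) : ℂ) * Complex.I) * f y‖ ^ 2

/-- The degree `deg_G(x) = m(x)⁻¹ Σ_y E(x,y)`. -/
def degree (E : V → V → ℝ) (m : V → ℝ) (x : V) : ℝ := (m x)⁻¹ * ∑' y, E x y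

/-- The squared norm of `f` in `ℓ²(V,m)`. -/
def nrmSq (m : V → ℝ) (f : V → ℂ) : ℝ := ∑' x, m x * ‖f x‖ ^ 2

/-- Membership in `ℓ²(V,m)`. -/
def MemL2 (m : V → ℝ) (f : V → ℂ) : Prop := Summable fun x => m x * ‖f x‖ ^ 2

/-- The quadratic form `⟨f, deg_G(·) f⟩` of the multiplication operator by the degree. -/
def degForm (E : V → V → ℝ) (m : V → ℝ) (f : V → ℂ) : ℝ :=
  ∑' x, m x * degree E m x * ‖f x‖ ^ 2

/-- Weight of the product of two weighted graphs. -/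
def prodM (m1 : V1 → ℝ) (m2 : V2 → ℝ) : V1 × V2 → ℝ := fun p => m1 p.1 * m2 p.2

/-- Edge weight of the product of `G1` by `G2` through `I ⊆ V2`. -/
def prodE (E1 : V1 → V1 → ℝ) (E2 : V2 → V2 → ℝ) (I : Set V2) :
    V1 × V2 → V1 × V2 → ℝ := fun p q =>
  (if p.2 = q.2 ∧ p.2 ∈ I then E1 p.1 q.1 else 0) + (if p.1 = q.1 then E2 p.2 q.2 else 0)

/-- Edge weight of the Cartesian product of `G1` by `G2`. -/
def cartE (E1 : V1 → V1 → ℝ) (m1 : V1 → ℝ) (E2 : V2 → V2 → ℝ) (m2 : V2 → ℝ) :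
    V1 × V2 → V1 × V2 → ℝ := fun p q =>
  (if p.2 = q.2 then E1 p.1 q.1 * m2 p.2 else 0) + (if p.1 = q.1 then m1 p.1 * E2 p.2 q.2 else 0)

/-- Magnetic potential of the product of `G1` by `G2`. -/
def prodTheta (θ1 : V1 → V1 → ℝ) (θ2 : V2 → V2 → ℝ) : V1 × V2 → V1 × V2 → ℝ := fun p q =>
  (if p.2 = q.2 then θ1 p.1 q.1 else 0) + (if p.1 = q.1 then θ2 p.2 q.2 else 0)

/-- Hypothesis (H1): `m1(x) → 0` as `x → ∞` (on an infinite vertex set). -/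
def H1cond (m1 : V1 → ℝ) : Prop :=
  Infinite V1 ∧ ∀ ε : ℝ, 0 < ε → {x : V1 | ε ≤ m1 x}.Finite

/-- Hypothesis (H3): the degree of `G1` is bounded. -/
def H3cond (E1 : V1 → V1 → ℝ) (m1 : V1 → ℝ) : Prop :=
  ∃ d : ℝ, ∀ x, degree E1 m1 x ≤ d

/-- The quadratic form of the operator `m1⁻¹(·) ⊗ Δ_{G2,θ2}` on `ℓ²(V1 × V2, m1 ⊗ m2)`:
`⟨f, (m1⁻¹(·) ⊗ Δ_{G2,θ2}) f⟩ = Σ_x Q_{G2,θ2}(f(x,·))`. -/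
def fiberForm (E2 θ2 : V2 → V2 → ℝ) (f : V1 × V2 → ℂ) : ℝ :=
  ∑' x : V1, quadForm E2 θ2 fun y => f (x, y)

/-- A simple cycle: closed walk of length `≥ 3` with pairwise distinct vertices. -/
def IsSimpleCycle (E : V → V → ℝ) (γ : ℕ → V) (N : ℕ) : Prop :=
  3 ≤ N ∧ γ N = γ 0 ∧ (∀ i < N, 0 < E (γ i) (γ (i + 1))) ∧
    ∀ i < N, ∀ j < N, γ i = γ j → i = j

/-- The weighted length of an edge, `L_G(x,y) = sqrt(min(m x, m y)/E x y)`. -/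
def edgeLength (E : V → V → ℝ) (m : V → ℝ) (x y : V) : ℝ :=
  Real.sqrt (min (m x) (m y) / E x y)

/-- The weighted length of a cycle. -/
def cycleLength (E : V → V → ℝ) (m : V → ℝ) (γ : ℕ → V) (N : ℕ) : ℝ :=
  ∑ i ∈ Finset.range N, edgeLength E m (γ i) (γ (i + 1))

/-- The (weighted) girth: infimum of the weighted lengths of simple cycles (`∞` if none). -/
def girth (E : V → V → ℝ) (m : V → ℝ) : ℝ≥0∞ :=
  ⨅ c : {c : (ℕ → V) × ℕ // IsSimpleCycle E c.1 c.2},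
    ENNReal.ofReal (cycleLength E m c.1.1 c.1.2)

/-- The radius of injectivity: half the girth. -/
def injRad (E : V → V → ℝ) (m : V → ℝ) : ℝ≥0∞ := girth E m / 2

/-- Min-max encoding: there is an `n`-dimensional subspace of finitely supported
functions (the form core) on which `Q ≤ lam ‖·‖²_{ℓ²(V,m)}`.  For the self-adjoint
operator associated to the form `Q` with form core `C_c(V)` this says
`N_lam(H) = dim ran 1_{(-∞,lam]}(H) ≥ n`. -/
def DimGE (Q : (V → ℂ) → ℝ) (m : V → ℝ) (lam : ℝ) (n : ℕ) : Prop :=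
  ∃ g : Fin n → V → ℂ, LinearIndependent ℂ g ∧
    (∀ i, (Function.support (g i)).Finite) ∧
    ∀ f ∈ Submodule.span ℂ (Set.range g), Q f ≤ lam * nrmSq m f

/-- Compact resolvent (equivalently: empty essential spectrum) of the non-negative
self-adjoint operator associated to the form `Q`, encoded via min-max:
`N_lam(H) < ∞` for every `lam`. -/
def CompactResolvent (Q : (V → ℂ) → ℝ) (m : V → ℝ) : Prop :=
  ∀ lam : ℝ, ∃ n : ℕ, ∀ k : ℕ, DimGE Q m lam k → k ≤ n

/-- The eigenvalue counting function `N_lam(H) = dim ran 1_{(-∞,lam]}(H)`,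
encoded via min-max over the form core. -/
def countEig (Q : (V → ℂ) → ℝ) (m : V → ℝ) (lam : ℝ) : ℕ :=
  sSup {k : ℕ | DimGE Q m lam k}

/-- The `n`-th eigenvalue (counted with multiplicity, `n` starting at `0`) of the
self-adjoint operator associated to `Q`, via the Courant min-max principle. -/
def eigVal (Q : (V → ℂ) → ℝ) (m : V → ℝ) (n : ℕ) : ℝ :=
  sInf {t : ℝ | DimGE Q m t (n + 1)}

/-- Equality of the form domains of the two non-negative forms `Q1`, `Q2`, both with
form core the finitely supported functions: by the closed graph theorem this is
equivalent to the equivalence of the form norms on the common core. -/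
def SameFormDomain (Q1 Q2 : (V → ℂ) → ℝ) (m : V → ℝ) : Prop :=
  ∃ c1 c2 : ℝ, 0 < c1 ∧ 0 < c2 ∧ ∀ f : V → ℂ, (Function.support f).Finite →
    c1 * (nrmSq m f + Q1 f) ≤ nrmSq m f + Q2 f ∧
      nrmSq m f + Q2 f ≤ c2 * (nrmSq m f + Q1 f)

lemma degree_prod [Fintype V2] {E1 : V1 → V1 → ℝ} {m1 : V1 → ℝ} (E2 : V2 → V2 → ℝ)
    (m2 : V2 → ℝ) (I : Set V2) (hG1 : GraphAxioms E1 m1) (x : V1) (y : V2) :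
    degree (prodE E1 E2 I) (prodM m1 m2) (x, y) =
      (m2 y)⁻¹ * (if y ∈ I then degree E1 m1 x else 0) + degree E2 m2 y / m1 x := by
  obtain ⟨-, hnn, hdiag, -, hfin⟩ := hG1
  set T : Finset V1 := insert x (hfin x).toFinset with hT
  have hE : ∀ z ∉ T, E1 x z = 0 := by
    intro z hz
    by_contra h
    exact hz (by simp [hT, lt_of_le_of_ne (hnn x z) (Ne.symm h)])
  have h1 : ∑' z, E1 x z = ∑ z ∈ T, E1 x z := tsum_eq_sum hE
  have hx : x ∈ T := by simp [hT]
  have h2 : ∑' q, prodE E1 E2 I (x, y) q =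
      ∑ q ∈ T ×ˢ (Finset.univ : Finset V2), prodE E1 E2 I (x, y) q := by
    refine tsum_eq_sum fun q hq => ?_
    have hq' : q.1 ∉ T := by simpa using hq
    have hne : x ≠ q.1 := fun h => hq' (h ▸ hx)
    simp [prodE, hE _ hq', hne]
  have h3 : ∑ q ∈ T ×ˢ (Finset.univ : Finset V2), prodE E1 E2 I (x, y) q =
      (if y ∈ I then ∑ z ∈ T, E1 x z else 0) + ∑ w, E2 y w := by
    simp only [prodE, Finset.sum_add_distrib, Finset.sum_product]
    congr 1
    · by_cases hy : y ∈ I <;> simp [hy]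
    · rw [Finset.sum_comm]
      simp [hx]
  unfold degree
  rw [h2, h3, h1, tsum_fintype, prodM, mul_inv]
  split_ifs <;> ring

/-- The energy of the edge from `x` to `y` in the quadratic form. -/
def edgeEnergy (E θ : V → V → ℝ) (f : V → ℂ) (x y : V) : ℝ :=
  E x y * ‖f x - Complex.exp (((θ x y : ℝ) : ℂ) * Complex.I) * f y‖ ^ 2

lemma edgeEnergy_nonneg {E : V → V → ℝ} (hE : ∀ x y, 0 ≤ E x y) (θ : V → V → ℝ) (f : V → ℂ)
    (x y : V) : 0 ≤ edgeEnergy E θ f x y :=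
  mul_nonneg (hE x y) (sq_nonneg _)

lemma edgeEnergy_le {E : V → V → ℝ} (hE : ∀ x y, 0 ≤ E x y) (θ : V → V → ℝ) (f : V → ℂ)
    (x y : V) : edgeEnergy E θ f x y ≤ 2 * (E x y * ‖f x‖ ^ 2 + E x y * ‖f y‖ ^ 2) := by
  have h := norm_sub_le (f x) (Complex.exp (((θ x y : ℝ) : ℂ) * Complex.I) * f y)
  rw [norm_mul, Complex.norm_exp_ofReal_mul_I, one_mul] at h
  have h2 : ‖f x - Complex.exp (((θ x y : ℝ) : ℂ) * Complex.I) * f y‖ ^ 2 ≤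
      2 * (‖f x‖ ^ 2 + ‖f y‖ ^ 2) :=
    (pow_le_pow_left₀ (norm_nonneg _) h 2).trans (by nlinarith [sq_nonneg (‖f x‖ - ‖f y‖)])
  calc edgeEnergy E θ f x y ≤ E x y * (2 * (‖f x‖ ^ 2 + ‖f y‖ ^ 2)) :=
        mul_le_mul_of_nonneg_left h2 (hE x y)
    _ = _ := by ring

lemma quadForm_eq_sum {E θ : V → V → ℝ} {f : V → ℂ} (T : Finset V)
    (hT : ∀ x y, x ∉ T ∨ y ∉ T → edgeEnergy E θ f x y = 0) :
    quadForm E θ f = (1 / 2) * ∑ x ∈ T, ∑ y ∈ T, edgeEnergy E θ f x y := by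
  change (1 / 2) * ∑' x, ∑' y, edgeEnergy E θ f x y = _
  rw [tsum_eq_sum (s := T) fun x hx => by simp [hT x _ (Or.inl hx)]]
  congr 1
  exact Finset.sum_congr rfl fun x _ => tsum_eq_sum fun y hy => hT x y (Or.inr hy)

lemma MagneticPotential.diag {E θ : V → V → ℝ} (h : MagneticPotential E θ) (x : V) :
    θ x x = 0 := by
  linarith [h.1 x x]

lemma edgeEnergy_prod {E1 θ1 : V1 → V1 → ℝ} {E2 θ2 : V2 → V2 → ℝ}
    (hE1 : ∀ x, E1 x x = 0) (hE2 : ∀ y, E2 y y = 0)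
    (hθ1 : MagneticPotential E1 θ1) (hθ2 : MagneticPotential E2 θ2)
    (I : Set V2) (f : V1 × V2 → ℂ) (x x' : V1) (y y' : V2) :
    edgeEnergy (prodE E1 E2 I) (prodTheta θ1 θ2) f (x, y) (x', y') =
      (if y = y' then (if y ∈ I then edgeEnergy E1 θ1 (fun z => f (z, y)) x x' else 0) else 0) +
        (if x = x' then edgeEnergy E2 θ2 (fun w => f (x, w)) y y' else 0) := by
  unfold edgeEnergy prodE prodTheta
  by_cases hx : x = x' <;> by_cases hy : y = y' <;> by_cases hyI : y ∈ I <;>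
    (try subst hx) <;> (try subst hy) <;> simp [*, hθ1.diag, hθ2.diag]

lemma exists_finset_edges {E : V → V → ℝ} {m : V → ℝ} (hG : GraphAxioms E m) (S : Finset V) :
    ∃ T : Finset V, S ⊆ T ∧ ∀ x y, x ∉ T ∨ y ∉ T → E x y = 0 ∨ x ∉ S ∧ y ∉ S := by
  obtain ⟨hsymm, hnn, -, -, hfin⟩ := hG
  refine ⟨S ∪ S.biUnion fun x => (hfin x).toFinset, Finset.subset_union_left, fun x y h => ?_⟩
  by_contra! hc
  have hpos : 0 < E x y := lt_of_le_of_ne (hnn x y) (Ne.symm hc.1)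
  have hpos' : 0 < E y x := hsymm x y ▸ hpos
  by_cases hx : x ∈ S
  · rcases h with h | h
    · exact h (Finset.mem_union_left _ hx)
    · exact h (Finset.mem_union_right _ (by simpa using ⟨x, hx, hpos⟩))
  · have hy := hc.2 hx
    rcases h with h | h
    · exact h (Finset.mem_union_right _ (by simpa using ⟨y, hy, hpos'⟩))
    · exact h (Finset.mem_union_left _ hy)

lemma quadForm_prod [Fintype V2] {E1 θ1 : V1 → V1 → ℝ} {E2 θ2 : V2 → V2 → ℝ}
    (hE1 : ∀ x, E1 x x = 0) (hE2 : ∀ y, E2 y y = 0)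
    (hθ1 : MagneticPotential E1 θ1) (hθ2 : MagneticPotential E2 θ2)
    (I : Set V2) {f : V1 × V2 → ℂ} {S T : Finset V1} (hST : S ⊆ T)
    (hf : ∀ x ∉ S, ∀ y, f (x, y) = 0)
    (hT : ∀ x y, x ∉ T ∨ y ∉ T → E1 x y = 0 ∨ x ∉ S ∧ y ∉ S) :
    quadForm (prodE E1 E2 I) (prodTheta θ1 θ2) f =
      (∑ y, if y ∈ I then quadForm E1 θ1 (fun z => f (z, y)) else 0) + fiberForm E2 θ2 f := by
  have h1 : ∀ y x x', x ∉ T ∨ x' ∉ T → edgeEnergy E1 θ1 (fun z => f (z, y)) x x' = 0 := by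
    intro y x x' h
    rcases hT x x' h with h | ⟨h, h'⟩
    · simp [edgeEnergy, h]
    · simp [edgeEnergy, hf _ h, hf _ h']
  have h2 : ∀ x ∉ T, ∀ y y', edgeEnergy E2 θ2 (fun w => f (x, w)) y y' = 0 := by
    intro x hx y y'
    simp [edgeEnergy, hf x fun h => hx (hST h)]
  have h3 : ∀ x, quadForm E2 θ2 (fun w => f (x, w)) =
      (1 / 2) * ∑ y, ∑ y', edgeEnergy E2 θ2 (fun w => f (x, w)) y y' :=
    fun x => quadForm_eq_sum Finset.univ (by simp)
  have h4 : fiberForm E2 θ2 f = ∑ x ∈ T, quadForm E2 θ2 fun w => f (x, w) :=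
    tsum_eq_sum fun x hx => by simp [h3, h2 x hx]
  rw [quadForm_eq_sum (T ×ˢ Finset.univ), h4]
  · simp only [h3, fun y => quadForm_eq_sum T (h1 y)]
    simp only [Finset.sum_product, edgeEnergy_prod hE1 hE2 hθ1 hθ2, Finset.sum_add_distrib,
      mul_add]
    congr 1
    · rw [Finset.sum_comm, Finset.mul_sum]
      refine Finset.sum_congr rfl fun y _ => ?_
      by_cases hy : y ∈ I <;> simp [hy]
    · rw [Finset.mul_sum]
      refine Finset.sum_congr rfl fun x hx => ?_
      congr 1
      refine Finset.sum_congr rfl fun y _ => ?_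
      rw [Finset.sum_comm]
      simp [hx]
  · rintro ⟨x, y⟩ ⟨x', y'⟩ h
    have h' : x ∉ T ∨ x' ∉ T := by simpa using h
    rw [edgeEnergy_prod hE1 hE2 hθ1 hθ2, h1 y x x' h']
    by_cases hx : x = x'
    · subst hx
      simp [h2 x (by simpa using h')]
    · simp [hx]

/-- The magnetic form is bounded by twice the degree form. -/
lemma quadForm_le_of_degree_le {E θ : V → V → ℝ} {m : V → ℝ} (hG : GraphAxioms E m)
    {f : V → ℂ} {S T : Finset V} (hf : ∀ x ∉ S, f x = 0)
    (hT : ∀ x y, x ∉ T ∨ y ∉ T → E x y = 0 ∨ x ∉ S ∧ y ∉ S) {d : ℝ}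
    (hd : ∀ x, degree E m x ≤ d) :
    quadForm E θ f ≤ 2 * d * ∑ x ∈ T, m x * ‖f x‖ ^ 2 := by
  obtain ⟨hsymm, hnn, -, hm, hfin⟩ := hG
  have hsum : ∀ x, ∑ y ∈ T, E x y ≤ d * m x := by
    intro x
    have hs : Summable (E x) := by
      refine summable_of_hasFiniteSupport ((hfin x).subset fun y hy => ?_)
      exact lt_of_le_of_ne (hnn x y) (Ne.symm hy)
    have h := hd x
    rw [degree, inv_mul_le_iff₀ (hm x)] at h
    linarith [hs.sum_le_tsum T fun y _ => hnn x y]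
  rw [quadForm_eq_sum T]
  · have h1 : ∑ x ∈ T, ∑ y ∈ T, E x y * ‖f x‖ ^ 2 ≤ d * ∑ x ∈ T, m x * ‖f x‖ ^ 2 := by
      rw [Finset.mul_sum]
      refine Finset.sum_le_sum fun x _ => ?_
      rw [← Finset.sum_mul, ← mul_assoc]
      exact mul_le_mul_of_nonneg_right (hsum x) (sq_nonneg _)
    have h2 : ∑ x ∈ T, ∑ y ∈ T, E x y * ‖f y‖ ^ 2 = ∑ x ∈ T, ∑ y ∈ T, E x y * ‖f x‖ ^ 2 := by
      rw [Finset.sum_comm]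
      exact Finset.sum_congr rfl fun x _ => Finset.sum_congr rfl fun y _ => by rw [hsymm]
    have h3 := Finset.sum_le_sum fun x (_ : x ∈ T) =>
      Finset.sum_le_sum fun y (_ : y ∈ T) => edgeEnergy_le hnn θ f x y
    simp only [← Finset.mul_sum, Finset.sum_add_distrib] at h3
    linarith
  · intro x y h
    rcases hT x y h with h | ⟨h, h'⟩
    · simp [edgeEnergy, h]
    · simp [edgeEnergy, hf _ h, hf _ h']

lemma quadForm_nonneg {E : V → V → ℝ} (hE : ∀ x y, 0 ≤ E x y) (θ : V → V → ℝ) (f : V → ℂ) :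
    0 ≤ quadForm E θ f :=
  mul_nonneg (by norm_num) (tsum_nonneg fun x => tsum_nonneg fun y => edgeEnergy_nonneg hE θ f x y)

lemma degree_nonneg {E : V → V → ℝ} {m : V → ℝ} (hG : GraphAxioms E m) (x : V) :
    0 ≤ degree E m x :=
  mul_nonneg (inv_nonneg.2 (hG.2.2.2.1 x).le) (tsum_nonneg (hG.2.1 x))

/-- Key-stone inequalities for a discrete cusp `G = G1 ×_I G2` with
`M = (sup deg_{G1}) · (max 1/m2)`:  pointwise bounds on the degree and the form
inequalities `m1⁻¹(·) ⊗ Δ_{G2,θ2} ≤ Δ_{G,θ} ≤ 2M + m1⁻¹(·) ⊗ Δ_{G2,θ2}` on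
finitely supported functions. -/
theorem keystone_inequalities
    [Fintype V2] [Nonempty V2]
    (E1 : V1 → V1 → ℝ) (m1 : V1 → ℝ) (θ1 : V1 → V1 → ℝ)
    (E2 : V2 → V2 → ℝ) (m2 : V2 → ℝ) (θ2 : V2 → V2 → ℝ)
    (I : Set V2) (hI : I.Nonempty)
    (hG1 : GraphAxioms E1 m1) (hG2 : GraphAxioms E2 m2)
    (hθ1 : MagneticPotential E1 θ1) (hθ2 : MagneticPotential E2 θ2)
    (hconn1 : Conn E1) (hconn2 : Conn E2)
    (hH1 : H1cond m1) (hH3 : H3cond E1 m1)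
    (M : ℝ) (hM : M = (⨆ x, degree E1 m1 x) * ⨆ y, (m2 y)⁻¹) :
    (∀ (x : V1) (y : V2),
        degree E2 m2 y / m1 x ≤ degree (prodE E1 E2 I) (prodM m1 m2) (x, y) ∧
          degree (prodE E1 E2 I) (prodM m1 m2) (x, y) ≤ degree E2 m2 y / m1 x + M) ∧
      ∀ f : V1 × V2 → ℂ, (Function.support f).Finite →
        fiberForm E2 θ2 f ≤ quadForm (prodE E1 E2 I) (prodTheta θ1 θ2) f ∧
          quadForm (prodE E1 E2 I) (prodTheta θ1 θ2) f ≤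
            2 * M * nrmSq (prodM m1 m2) f + fiberForm E2 θ2 f := by
  obtain ⟨d, hd⟩ := hH3
  have hle : ∀ x, degree E1 m1 x ≤ ⨆ x, degree E1 m1 x :=
    le_ciSup ⟨d, by rintro _ ⟨x, rfl⟩; exact hd x⟩
  have hle2 : ∀ y, (m2 y)⁻¹ ≤ ⨆ y, (m2 y)⁻¹ := le_ciSup (Set.finite_range _).bddAbove
  have hD : 0 ≤ ⨆ x, degree E1 m1 x := Real.iSup_nonneg (degree_nonneg hG1)
  have hm1 := hG1.2.2.2.1
  have hm2 := hG2.2.2.2.1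
  have hm2' : ∀ y, 0 ≤ (m2 y)⁻¹ := fun y => inv_nonneg.2 (hm2 y).le
  have hB : 0 ≤ ⨆ y, (m2 y)⁻¹ := Real.iSup_nonneg hm2'
  set D := ⨆ x, degree E1 m1 x
  set B := ⨆ y, (m2 y)⁻¹
  have hM0 : 0 ≤ M := hM ▸ mul_nonneg hD hB
  refine ⟨fun x y => ?_, fun f hf => ?_⟩
  · rw [degree_prod E2 m2 I hG1]
    split_ifs
    · have h := mul_nonneg (hm2' y) (degree_nonneg hG1 x)
      have h' := mul_le_mul (hle2 y) (hle x) (degree_nonneg hG1 x) hB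
      constructor <;> linarith
    · constructor <;> linarith
  · set S : Finset V1 := hf.toFinset.image Prod.fst with hS
    have hfS : ∀ x ∉ S, ∀ y, f (x, y) = 0 := by
      intro x hx y
      by_contra h
      exact hx (Finset.mem_image.2 ⟨(x, y), by simpa using h, rfl⟩)
    obtain ⟨T, hST, hT⟩ := exists_finset_edges hG1 S
    have hn : nrmSq (prodM m1 m2) f = ∑ y, m2 y * ∑ x ∈ T, m1 x * ‖f (x, y)‖ ^ 2 := by
      rw [nrmSq, tsum_eq_sum (s := T ×ˢ Finset.univ), Finset.sum_product_right]
      · refine Finset.sum_congr rfl fun y _ => ?_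
        rw [Finset.mul_sum]
        exact Finset.sum_congr rfl fun x _ => by simp only [prodM]; ring
      · rintro ⟨x, y⟩ h
        have h' : x ∉ T := by simpa using h
        simp [hfS x fun h => h' (hST h)]
    rw [quadForm_prod hG1.2.2.1 hG2.2.2.1 hθ1 hθ2 I hST hfS hT]
    constructor
    · refine le_add_of_nonneg_left (Finset.sum_nonneg fun y _ => ?_)
      split_ifs
      exacts [quadForm_nonneg hG1.2.1 _ _, le_rfl]
    · refine add_le_add_left ?_ _
      rw [hn, Finset.mul_sum]
      refine Finset.sum_le_sum fun y _ => ?_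
      have hN : 0 ≤ ∑ x ∈ T, m1 x * ‖f (x, y)‖ ^ 2 :=
        Finset.sum_nonneg fun x _ => mul_nonneg (hm1 x).le (sq_nonneg _)
      have hq := quadForm_le_of_degree_le (θ := θ1) hG1 (fun x hx => hfS x hx y) hT hle
      have hBm : 1 ≤ B * m2 y := by
        have h := mul_le_mul_of_nonneg_right (hle2 y) (hm2 y).le
        rwa [inv_mul_cancel₀ (hm2 y).ne'] at h
      split_ifs
      · refine hq.trans ?_
        have h := mul_le_mul_of_nonneg_left hBm (mul_nonneg hD hN)
        rw [hM]
        linarith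
      · exact mul_nonneg (by positivity) (mul_nonneg (hm2 y).le hN)

end MagneticCusp
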